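/- Let μ be a probability measure on ℝ^d and F ⊂ ℝ^d a closed nonempty set. Then the restriction of D_{μ,F} to F × F is a metric on F (it is symmetric, satisfies the triangle inequality, is finite, and vanishes exactly on the diagonal), and the topology it induces on F coincides with the subspace topology induced by the Euclidean metric. -/

import Mathlib

open MeasureTheory Metric Set ProbabilityTheory
open scoped ENNReal NNReal

noncomputable section

/-- Euclidean space `ℝ^d`. -/
abbrev Euc (d : ℕ) := EuclideanSpace ℝ (Fin d)

/-- The pseudo-distance-to-measure `δ_{μ,u}(x) = inf {r > 0 : μ(B(x,r)) > u}`. -/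
def pseudoDTM {d : ℕ} (μ : Measure (Euc d)) (u : ℝ) (x : Euc d) : ℝ :=
  sInf {r : ℝ | 0 < r ∧ u < (μ (ball x r)).toReal}

/-- The distance-to-measure `d_μ(x) = ((1/m) ∫₀^m δ_{μ,u}(x)^p du)^{1/p}`. -/
def dtm {d : ℕ} (m p : ℝ) (μ : Measure (Euc d)) (x : Euc d) : ℝ :=
  ((1 / m) * ∫ u in Ioc (0 : ℝ) m, pseudoDTM μ u x ^ p) ^ (1 / p)

/-- A Lipschitz path. -/
def IsLipschitzPath {d : ℕ} (γ : ℝ → Euc d) : Prop := ∃ K, LipschitzWith K γ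

/-- Euclidean length `|γ| = ∫₀¹ ‖γ'(t)‖ dt`. -/
def eucLength {d : ℕ} (γ : ℝ → Euc d) : ℝ := ∫ t in Icc (0 : ℝ) 1, ‖deriv γ t‖

/-- FDTM length `D_μ(γ) = ∫₀¹ d_μ(γ(t))^β ‖γ'(t)‖ dt`. -/
def fdtmLength {d : ℕ} (m p β : ℝ) (μ : Measure (Euc d)) (γ : ℝ → Euc d) : ℝ :=
  ∫ t in Icc (0 : ℝ) 1, dtm m p μ (γ t) ^ β * ‖deriv γ t‖

/-- Admissible paths `Γ_F(x,y)`: Lipschitz paths from `x` to `y` which may leave the domain `F`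
only along straight lines. -/
def AdmissiblePath {d : ℕ} (F : Set (Euc d)) (x y : Euc d) (γ : ℝ → Euc d) : Prop :=
  IsLipschitzPath γ ∧ γ 0 = x ∧ γ 1 = y ∧
    ∀ a b : ℝ, 0 ≤ a → b ≤ 1 →
      (∀ t ∈ Ioo a b, γ t ∉ F) →
      ∃ u : Euc d, ‖u‖ = 1 ∧
        ∀ᵐ t ∂(volume.restrict (Ioo a b)), deriv γ t = ‖deriv γ t‖ • u

/-- The Fermat distance-to-measure `D_{μ,F}(x,y) = inf_{γ ∈ Γ_F(x,y)} D_μ(γ)`. -/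
def fdtm {d : ℕ} (m p β : ℝ) (μ : Measure (Euc d)) (F : Set (Euc d)) (x y : Euc d) : ℝ :=
  sInf {L : ℝ | ∃ γ : ℝ → Euc d, AdmissiblePath F x y γ ∧ L = fdtmLength m p β μ γ}

/-- A geodesic: an admissible path realizing the FDTM. -/
def IsGeodesic {d : ℕ} (m p β : ℝ) (μ : Measure (Euc d)) (F : Set (Euc d)) (x y : Euc d)
    (γ : ℝ → Euc d) : Prop :=
  AdmissiblePath F x y γ ∧ fdtmLength m p β μ γ = fdtm m p β μ F x y

/-- FDTM length of the straight segment `[x,y]`. -/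
def segFDTM {d : ℕ} (m p β : ℝ) (μ : Measure (Euc d)) (x y : Euc d) : ℝ :=
  ‖x - y‖ * ∫ t in Icc (0 : ℝ) 1, dtm m p μ ((1 - t) • x + t • y) ^ β

/-- The explicit constant `λ = 2·c·ρ^{β+1}/(ρ−1)` with `c = (16·5^β + 1152·165^β)/m^{2+β}`
and `ρ = 1 + 32/m`. -/
def fdtmConst (m β : ℝ) : ℝ :=
  2 * ((16 * (5 : ℝ) ^ β + 1152 * (165 : ℝ) ^ β) / m ^ (2 + β)) * (1 + 32 / m) ^ (β + 1) /
    ((1 + 32 / m) - 1)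

/-- Support of a measure: points all of whose neighborhoods have positive mass. -/
def measSupport {d : ℕ} (μ : Measure (Euc d)) : Set (Euc d) :=
  {x | ∀ r : ℝ, 0 < r → 0 < μ (ball x r)}

/-- `(a,b)`-standard measure: `μ(B(x,r)) ≥ a·r^b` for `x ∈ supp(μ)` and `0 < r ≤ a^{-1/b}`. -/
def IsStandard {d : ℕ} (μ : Measure (Euc d)) (a b : ℝ) : Prop :=
  ∀ x ∈ measSupport μ, ∀ r : ℝ, 0 < r → r ≤ a ^ (-(1 / b)) → a * r ^ b ≤ (μ (ball x r)).toReal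

section PseudoDTM

variable {d : ℕ} (μ : Measure (Euc d))

lemma pseudoDTM_nonneg (u : ℝ) (x : Euc d) : 0 ≤ pseudoDTM μ u x :=
  Real.sInf_nonneg fun _ hr => hr.1.le

lemma bddBelow_pseudoDTM_set (u : ℝ) (x : Euc d) :
    BddBelow {r : ℝ | 0 < r ∧ u < (μ (ball x r)).toReal} :=
  ⟨0, fun _ hr => hr.1.le⟩

lemma dtm_nonneg {m : ℝ} (hm : 0 ≤ m) (p : ℝ) (x : Euc d) : 0 ≤ dtm m p μ x := by
  refine Real.rpow_nonneg (mul_nonneg (by positivity) ?_) _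
  exact integral_nonneg fun u => Real.rpow_nonneg (pseudoDTM_nonneg μ u x) _

variable [IsProbabilityMeasure μ]

lemma nonempty_pseudoDTM_set {u : ℝ} (hu : u < 1) (x : Euc d) :
    {r : ℝ | 0 < r ∧ u < (μ (ball x r)).toReal}.Nonempty := by
  have hmono : Monotone fun n : ℕ => ball x ((n : ℝ) + 1) := fun a b hab =>
    ball_subset_ball (by gcongr)
  have hunion : ⋃ n : ℕ, ball x ((n : ℝ) + 1) = univ := by
    refine eq_univ_of_forall fun z => mem_iUnion.2 ?_
    obtain ⟨n, hn⟩ := exists_nat_gt (dist z x)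
    exact ⟨n, mem_ball.2 (by linarith)⟩
  have htend := tendsto_measure_iUnion_atTop (μ := μ) hmono
  rw [hunion, measure_univ] at htend
  have htend' := (ENNReal.tendsto_toReal ENNReal.one_ne_top).comp htend
  rw [ENNReal.toReal_one] at htend'
  obtain ⟨n, hn⟩ := (htend'.eventually (lt_mem_nhds hu)).exists
  exact ⟨n + 1, by positivity, hn⟩

lemma pseudoDTM_mono {u v : ℝ} (huv : u ≤ v) (hv : v < 1) (x : Euc d) :
    pseudoDTM μ u x ≤ pseudoDTM μ v x :=
  csInf_le_csInf (bddBelow_pseudoDTM_set μ u x) (nonempty_pseudoDTM_set μ hv x)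
    fun _ hr => ⟨hr.1, huv.trans_lt hr.2⟩

lemma pseudoDTM_le_add_dist {u : ℝ} (hu : u < 1) (x y : Euc d) :
    pseudoDTM μ u x ≤ pseudoDTM μ u y + dist x y := by
  rw [← sub_le_iff_le_add]
  refine le_csInf (nonempty_pseudoDTM_set μ hu y) fun r hr => ?_
  rw [sub_le_iff_le_add]
  refine csInf_le (bddBelow_pseudoDTM_set μ u x) ⟨by linarith [hr.1, dist_nonneg (x := x) (y := y)],
    hr.2.trans_le ?_⟩
  refine ENNReal.toReal_mono (measure_ne_top μ _) (measure_mono ?_)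
  exact ball_subset_ball' (by rw [dist_comm y x])

lemma continuous_pseudoDTM {u : ℝ} (hu : u < 1) : Continuous (pseudoDTM μ u) :=
  (LipschitzWith.of_le_add fun x y => pseudoDTM_le_add_dist μ hu x y).continuous

lemma le_pseudoDTM {u r : ℝ} (hu : u < 1) {x : Euc d} (h : (μ (ball x r)).toReal ≤ u) :
    r ≤ pseudoDTM μ u x := by
  refine le_csInf (nonempty_pseudoDTM_set μ hu x) fun s hs => ?_
  by_contra! hsr
  refine absurd (hs.2.trans_le ?_) h.not_gt
  exact ENNReal.toReal_mono (measure_ne_top μ _) (measure_mono (ball_subset_ball hsr.le))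

lemma integrableOn_pseudoDTM_rpow {m p : ℝ} (hm1 : m < 1) (hp : 0 ≤ p) (x : Euc d) :
    IntegrableOn (fun u => pseudoDTM μ u x ^ p) (Ioc 0 m) := by
  have hmono : MonotoneOn (fun u => pseudoDTM μ u x ^ p) (Icc 0 m) := fun u _ v hv huv =>
    Real.rpow_le_rpow (pseudoDTM_nonneg μ u x)
      (pseudoDTM_mono μ huv (hv.2.trans_lt hm1) x) hp
  exact (hmono.integrableOn_isCompact isCompact_Icc).mono_set Ioc_subset_Icc_self

lemma continuous_dtm {m p : ℝ} (hm1 : m < 1) (hp : 1 ≤ p) :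
    Continuous (dtm m p μ) := by
  refine Continuous.rpow_const ?_ fun _ => Or.inr (by positivity)
  refine continuous_const.mul (continuous_iff_continuousAt.2 fun x₀ => ?_)
  refine continuousAt_of_dominated (bound := fun _ => (pseudoDTM μ m x₀ + 1) ^ p)
    (Filter.Eventually.of_forall fun x =>
      (integrableOn_pseudoDTM_rpow μ hm1 (by linarith) x).aestronglyMeasurable)
    ?_ (integrable_const _) ?_
  · filter_upwards [ball_mem_nhds x₀ one_pos] with x hx
    filter_upwards [ae_restrict_mem measurableSet_Ioc] with u hu
    rw [Real.norm_of_nonneg (Real.rpow_nonneg (pseudoDTM_nonneg μ u x) _)]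
    refine Real.rpow_le_rpow (pseudoDTM_nonneg μ u x) ?_ (by linarith)
    have h₁ := pseudoDTM_le_add_dist μ (hu.2.trans_lt hm1) x x₀
    have h₂ := pseudoDTM_mono μ hu.2 hm1 x₀
    have h₃ := mem_ball.1 hx
    linarith
  · filter_upwards [ae_restrict_mem measurableSet_Ioc] with u hu
    exact ((continuous_pseudoDTM μ (hu.2.trans_lt hm1)).rpow_const
      fun _ => Or.inr (by linarith)).continuousAt

lemma le_dtm_of_measure_ball_le {m p r : ℝ} (hm : m ∈ Ioo (0 : ℝ) 1) (hp : 1 ≤ p) (hr : 0 ≤ r)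
    {x : Euc d} (h : (μ (ball x r)).toReal ≤ m / 2) :
    r * (1 / 2) ^ (1 / p) ≤ dtm m p μ x := by
  obtain ⟨hm0, hm1⟩ := hm
  have hp0 : 0 < p := by linarith
  have hInt := integrableOn_pseudoDTM_rpow μ hm1 hp0.le x
  have hsub : Ioc (m / 2) m ⊆ Ioc 0 m := Ioc_subset_Ioc_left (by linarith)
  have hbound : m / 2 * r ^ p ≤ ∫ u in Ioc (0 : ℝ) m, pseudoDTM μ u x ^ p := by
    calc m / 2 * r ^ p = ∫ _ in Ioc (m / 2) m, r ^ p := by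
          rw [setIntegral_const, measureReal_def, Real.volume_Ioc,
            ENNReal.toReal_ofReal (by linarith), smul_eq_mul]
          ring
      _ ≤ ∫ u in Ioc (m / 2) m, pseudoDTM μ u x ^ p := by
          refine setIntegral_mono_on (integrable_const _) (hInt.mono_set hsub)
            measurableSet_Ioc fun u hu => ?_
          exact Real.rpow_le_rpow hr
            (le_pseudoDTM μ (hu.2.trans_lt hm1) (h.trans hu.1.le)) hp0.le
      _ ≤ ∫ u in Ioc (0 : ℝ) m, pseudoDTM μ u x ^ p :=
          setIntegral_mono_set hInt
            (Filter.Eventually.of_forall fun u => Real.rpow_nonneg (pseudoDTM_nonneg μ u x) _)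
            hsub.eventuallyLE
  have hr_eq : r * (1 / 2) ^ (1 / p) = (1 / m * (m / 2 * r ^ p)) ^ (1 / p) := by
    rw [show 1 / m * (m / 2 * r ^ p) = r ^ p * (1 / 2) by field_simp,
      Real.mul_rpow (by positivity) (by norm_num), one_div p, Real.rpow_rpow_inv hr hp0.ne']
  rw [hr_eq]
  exact Real.rpow_le_rpow (by positivity) (by gcongr) (by positivity)

lemma exists_punctured_ball_measure_lt (x : Euc d) {ε c : ℝ} (hε : 0 < ε) (hc : 0 < c) :
    ∃ δ > 0, δ ≤ ε ∧ (μ {z | 0 < dist z x ∧ dist z x < δ}).toReal < c := by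
  set S : ℕ → Set (Euc d) := fun n => {z | 0 < dist z x ∧ dist z x < 1 / ((n : ℝ) + 1)}
  have hanti : Antitone S := fun a b hab z hz =>
    ⟨hz.1, hz.2.trans_le (one_div_le_one_div_of_le (by positivity) (by gcongr))⟩
  have hdist : Continuous fun z => dist z x := continuous_id.dist continuous_const
  have hmeas : ∀ n, NullMeasurableSet (S n) μ := fun n =>
    ((isOpen_lt continuous_const hdist).inter
      (isOpen_lt hdist continuous_const)).measurableSet.nullMeasurableSet
  have hempty : ⋂ n, S n = ∅ := by
    refine eq_empty_of_forall_notMem fun z hz => ?_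
    obtain ⟨n, hn⟩ := exists_nat_one_div_lt (mem_iInter.1 hz 0).1
    exact lt_asymm hn (mem_iInter.1 hz n).2
  have htend := tendsto_measure_iInter_atTop hmeas hanti ⟨0, measure_ne_top μ _⟩
  rw [hempty, measure_empty] at htend
  have htend' := (ENNReal.tendsto_toReal ENNReal.zero_ne_top).comp htend
  rw [ENNReal.toReal_zero] at htend'
  obtain ⟨n, hn, hnε⟩ := ((htend'.eventually (gt_mem_nhds hc)).and
    (tendsto_one_div_add_atTop_nhds_zero_nat.eventually (gt_mem_nhds hε))).exists
  exact ⟨1 / (n + 1), by positivity, hnε.le, hn⟩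

end PseudoDTM

section Paths

lemma deriv_comp_mul_add {E : Type*} [NormedAddCommGroup E] [NormedSpace ℝ E] (γ : ℝ → E)
    (c e t : ℝ) : deriv (fun s => γ (c * s + e)) t = c • deriv γ (c * t + e) := by
  rw [deriv_comp_mul_left c (fun s => γ (s + e)) t, deriv_comp_add_const]

lemma quasiMeasurePreserving_mul_add {c : ℝ} (hc : c ≠ 0) (e : ℝ) :
    Measure.QuasiMeasurePreserving (fun t : ℝ => c * t + e) volume volume := by
  refine (measurePreserving_add_right volume e).quasiMeasurePreserving.comp
    ⟨measurable_const_mul c, ?_⟩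
  rw [Real.map_volume_mul_left hc]
  exact Measure.smul_absolutelyContinuous

lemma lipschitzWith_mul_add (c e : ℝ) : LipschitzWith ‖c‖₊ fun t : ℝ => c * t + e :=
  LipschitzWith.of_dist_le_mul fun _ _ => by
    rw [Real.dist_eq, Real.dist_eq, coe_nnnorm, Real.norm_eq_abs, ← abs_mul]
    exact le_of_eq (by ring_nf)

variable {d : ℕ} {m p β : ℝ} {μ : Measure (Euc d)} {F : Set (Euc d)} {x y z : Euc d}
  {γ γ₁ γ₂ : ℝ → Euc d}

lemma fdtmLength_eq_intervalIntegral (m p β : ℝ) (μ : Measure (Euc d)) (γ : ℝ → Euc d) :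
    fdtmLength m p β μ γ = ∫ t in (0 : ℝ)..1, dtm m p μ (γ t) ^ β * ‖deriv γ t‖ := by
  rw [fdtmLength, intervalIntegral.integral_of_le zero_le_one, integral_Icc_eq_integral_Ioc]

lemma fdtmLength_nonneg (hm : 0 ≤ m) (γ : ℝ → Euc d) : 0 ≤ fdtmLength m p β μ γ :=
  integral_nonneg fun _ => mul_nonneg (Real.rpow_nonneg (dtm_nonneg μ hm p _) _) (norm_nonneg _)

lemma IsLipschitzPath.integrable_fdtm [IsProbabilityMeasure μ] (hm1 : m < 1) (hp : 1 ≤ p)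
    (hβ : 0 ≤ β) (hγ : IsLipschitzPath γ) (a b : ℝ) :
    IntervalIntegrable (fun t => dtm m p μ (γ t) ^ β * ‖deriv γ t‖) volume a b := by
  obtain ⟨K, hK⟩ := hγ
  have hcont : Continuous fun t => dtm m p μ (γ t) ^ β :=
    ((continuous_dtm μ hm1 hp).comp hK.continuous).rpow_const fun _ => Or.inr hβ
  refine IntervalIntegrable.continuousOn_mul ?_ hcont.continuousOn
  refine (intervalIntegrable_const (c := (K : ℝ))).mono_fun
    (measurable_deriv γ).norm.aestronglyMeasurable (Filter.Eventually.of_forall fun t => ?_)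
  simpa using norm_deriv_le_of_lipschitz hK

/-- Outside `F`, an affine reparametrization of an admissible path moves in a fixed direction. -/
lemma AdmissiblePath.exists_direction_comp (h : AdmissiblePath F x y γ) {c e a b a' b' : ℝ}
    (hc : c ≠ 0) (ha' : 0 ≤ a') (hb' : b' ≤ 1)
    (hmaps : ∀ t, t ∈ Ioo a b ↔ c * t + e ∈ Ioo a' b')
    (hF : ∀ t ∈ Ioo a b, γ (c * t + e) ∉ F) :
    ∃ u : Euc d, ‖u‖ = 1 ∧ ∀ᵐ t ∂(volume.restrict (Ioo a b)),
      c • deriv γ (c * t + e) = ‖c • deriv γ (c * t + e)‖ • u := by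
  obtain ⟨u, hu, hder⟩ := h.2.2.2 a' b' ha' hb' fun s hs => by
    have hs' : c * ((s - e) / c) + e = s := by field_simp; ring
    rw [← hs']
    exact hF _ ((hmaps _).2 (by rwa [hs']))
  rw [ae_restrict_iff' measurableSet_Ioo] at hder
  have hder' := (quasiMeasurePreserving_mul_add hc e).ae hder
  obtain ⟨σ, hσ, hcσ⟩ : ∃ σ : ℝ, |σ| = 1 ∧ c = |c| * σ := by
    rcases hc.lt_or_gt with hneg | hpos
    · exact ⟨-1, by simp, by rw [abs_of_neg hneg]; ring⟩
    · exact ⟨1, by simp, by rw [abs_of_pos hpos]; ring⟩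
  refine ⟨σ • u, by rw [norm_smul, hu, Real.norm_eq_abs, hσ, one_mul], ?_⟩
  rw [ae_restrict_iff' measurableSet_Ioo]
  filter_upwards [hder'] with t ht hmem
  rw [norm_smul, smul_smul, Real.norm_eq_abs]
  conv_lhs => rw [ht ((hmaps t).1 hmem), smul_smul]
  congr 1
  rw [mul_right_comm, ← hcσ]

lemma AdmissiblePath.reverse (h : AdmissiblePath F x y γ) :
    AdmissiblePath F y x fun t => γ (-1 * t + 1) := by
  obtain ⟨K, hK⟩ := h.1
  refine ⟨⟨_, hK.comp (lipschitzWith_mul_add (-1) 1)⟩, by simp [h.2.2.1], by simp [h.2.1],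
    fun a b ha hb hF => ?_⟩
  simp_rw [deriv_comp_mul_add]
  refine h.exists_direction_comp (a' := 1 - b) (b' := 1 - a) (by norm_num) (by linarith)
    (by linarith) (fun t => ?_) hF
  constructor <;> rintro ⟨h₁, h₂⟩ <;> constructor <;> linarith

lemma fdtmLength_reverse (m p β : ℝ) (μ : Measure (Euc d)) (γ : ℝ → Euc d) :
    fdtmLength m p β μ (fun t => γ (-1 * t + 1)) = fdtmLength m p β μ γ := by
  simp_rw [fdtmLength_eq_intervalIntegral, deriv_comp_mul_add, neg_smul, one_smul, norm_neg]
  rw [intervalIntegral.integral_comp_mul_add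
    (fun t => dtm m p μ (γ t) ^ β * ‖deriv γ t‖) (by norm_num : (-1 : ℝ) ≠ 0) 1]
  rw [intervalIntegral.integral_symm]
  norm_num

/-- Concatenation of two paths meeting at `y`, each run at double speed. -/
def pathConcat (y : Euc d) (γ₁ γ₂ : ℝ → Euc d) (t : ℝ) : Euc d :=
  γ₁ (2 * min t (1 / 2) + 0) + γ₂ (2 * max t (1 / 2) + -1) - y

lemma pathConcat_of_le (h₂ : γ₂ 0 = y) {t : ℝ} (ht : t ≤ 1 / 2) :
    pathConcat y γ₁ γ₂ t = γ₁ (2 * t + 0) := by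
  rw [pathConcat, min_eq_left ht, max_eq_right ht, show (2 : ℝ) * (1 / 2) + -1 = 0 by norm_num,
    h₂, add_sub_cancel_right]

lemma pathConcat_of_ge (h₁ : γ₁ 1 = y) {t : ℝ} (ht : 1 / 2 ≤ t) :
    pathConcat y γ₁ γ₂ t = γ₂ (2 * t + -1) := by
  rw [pathConcat, min_eq_right ht, max_eq_left ht, show (2 : ℝ) * (1 / 2) + 0 = 1 by norm_num,
    h₁, add_sub_cancel_left]

lemma deriv_pathConcat_of_lt (h₂ : γ₂ 0 = y) {t : ℝ} (ht : t < 1 / 2) :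
    deriv (pathConcat y γ₁ γ₂) t = (2 : ℝ) • deriv γ₁ (2 * t + 0) := by
  rw [← deriv_comp_mul_add]
  refine Filter.EventuallyEq.deriv_eq ?_
  filter_upwards [gt_mem_nhds ht] with s hs using pathConcat_of_le h₂ hs.le

lemma deriv_pathConcat_of_gt (h₁ : γ₁ 1 = y) {t : ℝ} (ht : 1 / 2 < t) :
    deriv (pathConcat y γ₁ γ₂) t = (2 : ℝ) • deriv γ₂ (2 * t + -1) := by
  rw [← deriv_comp_mul_add]
  refine Filter.EventuallyEq.deriv_eq ?_
  filter_upwards [lt_mem_nhds ht] with s hs using pathConcat_of_ge h₁ hs.le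

lemma IsLipschitzPath.pathConcat (h₁ : IsLipschitzPath γ₁) (h₂ : IsLipschitzPath γ₂)
    (y : Euc d) : IsLipschitzPath (pathConcat y γ₁ γ₂) := by
  obtain ⟨K₁, hK₁⟩ := h₁
  obtain ⟨K₂, hK₂⟩ := h₂
  exact ⟨_, ((hK₁.comp ((lipschitzWith_mul_add 2 0).comp (LipschitzWith.id.min_const (1 / 2)))).add
    (hK₂.comp ((lipschitzWith_mul_add 2 (-1)).comp (LipschitzWith.id.max_const (1 / 2))))).sub
    (LipschitzWith.const y)⟩

lemma AdmissiblePath.pathConcat (hy : y ∈ F) (h₁ : AdmissiblePath F x y γ₁)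
    (h₂ : AdmissiblePath F y z γ₂) : AdmissiblePath F x z (pathConcat y γ₁ γ₂) := by
  have e₁ := h₁.2.2.1
  have e₂ := h₂.2.1
  refine ⟨h₁.1.pathConcat h₂.1 y, ?_, ?_, fun a b ha hb hF => ?_⟩
  · rw [pathConcat_of_le e₂ (by norm_num)]
    simpa using h₁.2.1
  · rw [pathConcat_of_ge e₁ (by norm_num)]
    norm_num [h₂.2.2.1]
  · have hmid : b ≤ 1 / 2 ∨ 1 / 2 ≤ a := by
      by_contra! hcon
      refine hF (1 / 2) ⟨hcon.2, hcon.1⟩ ?_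
      rw [pathConcat_of_le e₂ le_rfl]
      norm_num [e₁, hy]
    rcases hmid with hb' | ha'
    · obtain ⟨u, hu, hder⟩ := h₁.exists_direction_comp (c := 2) (e := 0) (a := a) (b := b)
        (a' := 2 * a) (b' := 2 * b) two_ne_zero (by linarith) (by linarith)
        (fun t => by constructor <;> rintro ⟨h₁, h₂⟩ <;> constructor <;> linarith)
        fun t ht => by simpa only [pathConcat_of_le e₂ (ht.2.le.trans hb')] using hF t ht
      refine ⟨u, hu, ?_⟩
      filter_upwards [hder, ae_restrict_mem measurableSet_Ioo] with t ht hmem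
      rwa [deriv_pathConcat_of_lt e₂ (hmem.2.trans_le hb')]
    · obtain ⟨u, hu, hder⟩ := h₂.exists_direction_comp (c := 2) (e := -1) (a := a) (b := b)
        (a' := 2 * a - 1) (b' := 2 * b - 1) two_ne_zero (by linarith) (by linarith)
        (fun t => by constructor <;> rintro ⟨h₁, h₂⟩ <;> constructor <;> linarith)
        fun t ht => by simpa only [pathConcat_of_ge e₁ (ha'.trans ht.1.le)] using hF t ht
      refine ⟨u, hu, ?_⟩
      filter_upwards [hder, ae_restrict_mem measurableSet_Ioo] with t ht hmem
      rwa [deriv_pathConcat_of_gt e₁ (ha'.trans_lt hmem.1)]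

lemma fdtmLength_pathConcat [IsProbabilityMeasure μ] (hm1 : m < 1) (hp : 1 ≤ p) (hβ : 0 ≤ β)
    (hγ₁ : IsLipschitzPath γ₁) (hγ₂ : IsLipschitzPath γ₂) (h₁ : γ₁ 1 = y) (h₂ : γ₂ 0 = y) :
    fdtmLength m p β μ (pathConcat y γ₁ γ₂) =
      fdtmLength m p β μ γ₁ + fdtmLength m p β μ γ₂ := by
  have hInt := (hγ₁.pathConcat hγ₂ y).integrable_fdtm (μ := μ) hm1 hp hβ
  simp_rw [fdtmLength_eq_intervalIntegral]
  rw [← intervalIntegral.integral_add_adjacent_intervals (hInt 0 (1 / 2)) (hInt (1 / 2) 1)]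
  congr 1
  · calc
      _ = ∫ t in (0 : ℝ)..(1 / 2),
          2 * (dtm m p μ (γ₁ (2 * t + 0)) ^ β * ‖deriv γ₁ (2 * t + 0)‖) := by
        refine intervalIntegral.integral_congr_Ioo_of_le (by norm_num) fun t ht => ?_
        simp only [pathConcat_of_le h₂ ht.2.le, deriv_pathConcat_of_lt h₂ ht.2, norm_smul]
        norm_num
        ring
      _ = _ := by
        rw [intervalIntegral.integral_const_mul, intervalIntegral.integral_comp_mul_add
          (fun t => dtm m p μ (γ₁ t) ^ β * ‖deriv γ₁ t‖) (two_ne_zero' ℝ) 0]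
        norm_num
        ring
  · calc
      _ = ∫ t in (1 / 2 : ℝ)..1,
          2 * (dtm m p μ (γ₂ (2 * t + -1)) ^ β * ‖deriv γ₂ (2 * t + -1)‖) := by
        refine intervalIntegral.integral_congr_Ioo_of_le (by norm_num) fun t ht => ?_
        simp only [pathConcat_of_ge h₁ ht.1.le, deriv_pathConcat_of_gt h₁ ht.1, norm_smul]
        norm_num
        ring
      _ = _ := by
        rw [intervalIntegral.integral_const_mul, intervalIntegral.integral_comp_mul_add
          (fun t => dtm m p μ (γ₂ t) ^ β * ‖deriv γ₂ t‖) (two_ne_zero' ℝ) (-1)]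
        norm_num
        ring

lemma admissiblePath_segment (hd : d ≠ 0) (F : Set (Euc d)) (x y : Euc d) :
    AdmissiblePath F x y fun t => t • (y - x) + x := by
  refine ⟨⟨‖y - x‖₊, LipschitzWith.of_dist_le_mul fun s t => ?_⟩, by simp, by simp,
    fun a b _ _ _ => ?_⟩
  · rw [dist_add_right, dist_eq_norm, ← sub_smul, norm_smul, mul_comm, coe_nnnorm, dist_eq_norm]
  have hder : ∀ t, deriv (fun t : ℝ => t • (y - x) + x) t = y - x := fun t => by
    simpa using (((hasDerivAt_id t).smul_const (y - x)).add_const x).deriv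
  simp_rw [hder]
  rcases eq_or_ne (y - x) 0 with h0 | h0
  · have : NeZero d := ⟨hd⟩
    obtain ⟨u, hu⟩ := exists_norm_eq (Euc d) zero_le_one
    exact ⟨u, hu, by simp [h0]⟩
  · refine ⟨‖y - x‖⁻¹ • (y - x), norm_smul_inv_norm h0, Filter.Eventually.of_forall fun _ => ?_⟩
    rw [smul_smul, mul_inv_cancel₀ (norm_ne_zero_iff.2 h0), one_smul]

lemma fdtmLength_segment_le (hm : 0 ≤ m) (hβ : 0 ≤ β) {C r : ℝ}
    (hC : ∀ z ∈ ball x r, dtm m p μ z ≤ C) (hy : y ∈ ball x r) :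
    fdtmLength m p β μ (fun t => t • (y - x) + x) ≤ C ^ β * dist x y := by
  rw [fdtmLength_eq_intervalIntegral]
  have hx : x ∈ ball x r := mem_ball_self (dist_nonneg.trans_lt hy)
  refine (Real.le_norm_self _).trans ((intervalIntegral.norm_integral_le_of_norm_le_const
    (C := C ^ β * dist x y) fun t ht => ?_).trans_eq (by norm_num))
  rw [uIoc_of_le zero_le_one] at ht
  have hder : deriv (fun t : ℝ => t • (y - x) + x) t = y - x := by
    simpa using (((hasDerivAt_id t).smul_const (y - x)).add_const x).deriv
  have hmem : t • (y - x) + x ∈ ball x r := by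
    rw [add_comm]
    exact (convex_ball x r).add_smul_sub_mem hx hy ⟨ht.1.le, ht.2⟩
  have hnn := dtm_nonneg μ hm p (t • (y - x) + x)
  rw [hder, norm_mul, norm_norm, Real.norm_of_nonneg (Real.rpow_nonneg hnn _), dist_comm,
    dist_eq_norm]
  gcongr
  exact hC _ hmem

/-- A path leaving a ball has length at least the density's lower bound on an annulus times the
width of that annulus. -/
lemma le_fdtmLength_of_annulus [IsProbabilityMeasure μ] (hm : m ∈ Ioo (0 : ℝ) 1) (hp : 1 ≤ p)
    (hβ : 0 ≤ β) {c s₀ s₁ : ℝ} (hc : 0 ≤ c) (hs₀ : 0 ≤ s₀) (hs : s₀ ≤ s₁)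
    (hdtm : ∀ z, dist z x ∈ Icc s₀ s₁ → c ≤ dtm m p μ z)
    (hγ : IsLipschitzPath γ) (h0 : γ 0 = x) (h1 : s₁ ≤ dist (γ 1) x) :
    c ^ β * (s₁ - s₀) ≤ fdtmLength m p β μ γ := by
  have hInt := hγ.integrable_fdtm (μ := μ) hm.2 hp hβ 0 1
  obtain ⟨K, hK⟩ := hγ
  set g : ℝ → ℝ := fun t => max s₀ (min s₁ (dist (γ t) x)) with hg
  have hg_dist : ∀ s t, dist (g s) (g t) ≤ dist (γ s) (γ t) := fun s t =>
    (((LipschitzWith.dist_left x).const_min s₁).const_max s₀).dist_le_mul (γ s) (γ t) |>.trans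
      (by simp)
  have hgK : LipschitzWith K g :=
    LipschitzWith.of_dist_le_mul fun s t => (hg_dist s t).trans (hK.dist_le_mul s t)
  have hac := (hgK.lipschitzOnWith (s := uIcc 0 1)).absolutelyContinuousOnInterval
  have hg_bound : ∀ t, DifferentiableAt ℝ γ t → deriv g t ≤ ‖deriv γ t‖ := by
    refine fun t hγt => le_of_forall_pos_le_add fun ε hε => (le_abs_self _).trans ?_
    rw [← Real.norm_eq_abs]
    refine norm_deriv_le_of_lip' (by positivity) ?_
    filter_upwards [(hasDerivAt_iff_isLittleO.1 hγt.hasDerivAt).def hε] with s hs'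
    calc ‖g s - g t‖ ≤ ‖γ s - γ t‖ := by simpa only [dist_eq_norm] using hg_dist s t
      _ ≤ ‖γ s - γ t - (s - t) • deriv γ t‖ + ‖(s - t) • deriv γ t‖ := by
          simpa using norm_add_le (γ s - γ t - (s - t) • deriv γ t) ((s - t) • deriv γ t)
      _ ≤ (‖deriv γ t‖ + ε) * ‖s - t‖ := by
          rw [norm_smul]
          linarith
  have hg_zero : ∀ t, dist (γ t) x ∉ Icc s₀ s₁ → deriv g t = 0 := by
    intro t ht
    have hcont : Filter.Tendsto (fun s => dist (γ s) x) (nhds t) (nhds (dist (γ t) x)) :=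
      (hK.continuous.dist continuous_const).tendsto t
    rw [mem_Icc, not_and_or, not_le, not_le] at ht
    rcases ht with ht | ht
    · have : g =ᶠ[nhds t] fun _ => s₀ := by
        filter_upwards [hcont.eventually (gt_mem_nhds ht)] with s hs'
        simp only [hg, max_eq_left ((min_le_right _ _).trans hs'.le)]
      rw [this.deriv_eq, deriv_const]
    · have : g =ᶠ[nhds t] fun _ => s₁ := by
        filter_upwards [hcont.eventually (lt_mem_nhds ht)] with s hs'
        simp only [hg, min_eq_left hs'.le, max_eq_right hs]
      rw [this.deriv_eq, deriv_const]
  have hg0 : g 0 = s₀ := by simp [hg, h0, hs₀]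
  have hg1 : g 1 = s₁ := by simp only [hg, min_eq_left h1, max_eq_right hs]
  rw [fdtmLength_eq_intervalIntegral, ← hg0, ← hg1, ← hac.integral_deriv_eq_sub,
    ← intervalIntegral.integral_const_mul]
  refine intervalIntegral.integral_mono_ae zero_le_one
    (hac.intervalIntegrable_deriv.const_mul _) hInt ?_
  filter_upwards [hK.ae_differentiableAt_real] with t ht
  by_cases hmem : dist (γ t) x ∈ Icc s₀ s₁
  · calc c ^ β * deriv g t ≤ c ^ β * ‖deriv γ t‖ := by gcongr; exact hg_bound t ht
      _ ≤ dtm m p μ (γ t) ^ β * ‖deriv γ t‖ := by gcongr; exact hdtm _ hmem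
  · rw [hg_zero t hmem, mul_zero]
    exact mul_nonneg (Real.rpow_nonneg (dtm_nonneg μ hm.1.le p _) _) (norm_nonneg _)

lemma fdtm_set_nonempty (hd : d ≠ 0) (m p β : ℝ) (μ : Measure (Euc d)) (F : Set (Euc d))
    (x y : Euc d) :
    {L : ℝ | ∃ γ : ℝ → Euc d, AdmissiblePath F x y γ ∧ L = fdtmLength m p β μ γ}.Nonempty :=
  ⟨_, _, admissiblePath_segment hd F x y, rfl⟩

lemma fdtm_le_fdtmLength (hm : 0 ≤ m) (h : AdmissiblePath F x y γ) :
    fdtm m p β μ F x y ≤ fdtmLength m p β μ γ :=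
  csInf_le ⟨0, by rintro _ ⟨γ, -, rfl⟩; exact fdtmLength_nonneg hm γ⟩ ⟨γ, h, rfl⟩

lemma fdtm_nonneg (hm : 0 ≤ m) : 0 ≤ fdtm m p β μ F x y :=
  Real.sInf_nonneg (by rintro _ ⟨γ, -, rfl⟩; exact fdtmLength_nonneg hm γ)

lemma fdtm_comm (m p β : ℝ) (μ : Measure (Euc d)) (F : Set (Euc d)) (x y : Euc d) :
    fdtm m p β μ F x y = fdtm m p β μ F y x := by
  unfold fdtm
  congr 1
  ext L
  constructor <;> rintro ⟨γ, hγ, rfl⟩ <;>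
    exact ⟨_, hγ.reverse, (fdtmLength_reverse m p β μ γ).symm⟩

lemma fdtm_triangle [IsProbabilityMeasure μ] (hd : d ≠ 0) (hm : m ∈ Ioo (0 : ℝ) 1) (hp : 1 ≤ p)
    (hβ : 0 ≤ β) (hy : y ∈ F) :
    fdtm m p β μ F x z ≤ fdtm m p β μ F x y + fdtm m p β μ F y z := by
  refine le_of_forall_pos_le_add fun ε hε => ?_
  obtain ⟨_, ⟨γ₁, hγ₁, rfl⟩, h₁⟩ := exists_lt_of_csInf_lt
    (fdtm_set_nonempty hd m p β μ F x y) (lt_add_of_pos_right _ (half_pos hε))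
  obtain ⟨_, ⟨γ₂, hγ₂, rfl⟩, h₂⟩ := exists_lt_of_csInf_lt
    (fdtm_set_nonempty hd m p β μ F y z) (lt_add_of_pos_right _ (half_pos hε))
  have hle := fdtm_le_fdtmLength (p := p) (β := β) (μ := μ) hm.1.le (hγ₁.pathConcat hy hγ₂)
  rw [fdtmLength_pathConcat hm.2 hp hβ hγ₁.1 hγ₂.1 hγ₁.2.2.1 hγ₂.2.1] at hle
  unfold fdtm at hle ⊢
  linarith

lemma exists_forall_fdtm_le_mul_dist [IsProbabilityMeasure μ] (hd : d ≠ 0)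
    (hm : m ∈ Ioo (0 : ℝ) 1) (hp : 1 ≤ p) (hβ : 0 ≤ β) (F : Set (Euc d)) (x : Euc d) :
    ∃ C > 0, ∀ y, dist x y < 1 → fdtm m p β μ F x y ≤ C * dist x y := by
  obtain ⟨C, hC⟩ := (isCompact_closedBall x 1).bddAbove_image
    (continuous_dtm (p := p) μ hm.2 hp).continuousOn
  refine ⟨(max C 1) ^ β, by positivity, fun y hy => ?_⟩
  refine (fdtm_le_fdtmLength hm.1.le (admissiblePath_segment hd F x y)).trans
    (fdtmLength_segment_le (r := 1) hm.1.le hβ (fun z hz => ?_) (mem_ball'.2 hy))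
  exact (hC (mem_image_of_mem _ (ball_subset_closedBall hz))).trans (le_max_left _ _)

lemma exists_pos_forall_dist_lt [IsProbabilityMeasure μ] (hd : d ≠ 0) (hm : m ∈ Ioo (0 : ℝ) 1)
    (hp : 1 ≤ p) (hβ : 0 ≤ β) (F : Set (Euc d)) (x : Euc d) {ε : ℝ} (hε : 0 < ε) :
    ∃ η > 0, ∀ y, fdtm m p β μ F x y < η → dist x y < ε := by
  obtain ⟨δ, hδ, hδε, hμ⟩ := exists_punctured_ball_measure_lt μ x hε (half_pos hm.1)
  have hlow : ∀ z, dist z x ∈ Icc (δ / 3) (2 * δ / 3) →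
      δ / 3 * (1 / 2) ^ (1 / p) ≤ dtm m p μ z := fun z hz => by
    refine le_dtm_of_measure_ball_le μ hm hp (by positivity) (le_trans ?_ hμ.le)
    refine ENNReal.toReal_mono (measure_ne_top μ _) (measure_mono fun w hw => ?_)
    have h₁ := dist_triangle w z x
    have h₂ := dist_triangle_left z x w
    have h₃ := mem_ball.1 hw
    constructor <;> linarith [hz.1, hz.2]
  refine ⟨(δ / 3 * (1 / 2) ^ (1 / p)) ^ β * (2 * δ / 3 - δ / 3), ?_, fun y hy => ?_⟩
  · have : 0 < 2 * δ / 3 - δ / 3 := by linarith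
    positivity
  · by_contra! hxy
    refine hy.not_ge (le_csInf (fdtm_set_nonempty hd m p β μ F x y) ?_)
    rintro _ ⟨γ, hγ, rfl⟩
    refine le_fdtmLength_of_annulus hm hp hβ (by positivity) (by positivity) (by linarith) hlow
      hγ.1 hγ.2.1 ?_
    rw [hγ.2.2.1, dist_comm]
    linarith

end Paths

theorem fdtm_metric_and_topology {d : ℕ} (m p β : ℝ) (hm : m ∈ Set.Ioo (0 : ℝ) 1) (hp : 1 ≤ p)
    (hβ : 1 ≤ β) (μ : Measure (Euc d)) [IsProbabilityMeasure μ]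
    (F : Set (Euc d)) (hF : IsClosed F) (hFne : F.Nonempty) :
    (∀ x ∈ F, ∀ y ∈ F, 0 ≤ fdtm m p β μ F x y) ∧
    (∀ x ∈ F, ∀ y ∈ F, fdtm m p β μ F x y = fdtm m p β μ F y x) ∧
    (∀ x ∈ F, ∀ y ∈ F, ∀ z ∈ F,
      fdtm m p β μ F x z ≤ fdtm m p β μ F x y + fdtm m p β μ F y z) ∧
    (∀ x ∈ F, ∀ y ∈ F, (fdtm m p β μ F x y = 0 ↔ x = y)) ∧
    (∀ x ∈ F, ∀ ε : ℝ, 0 < ε → ∃ η > (0 : ℝ), ∀ y ∈ F, dist x y < η → fdtm m p β μ F x y < ε) ∧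
    (∀ x ∈ F, ∀ ε : ℝ, 0 < ε → ∃ η > (0 : ℝ), ∀ y ∈ F, fdtm m p β μ F x y < η → dist x y < ε) := by
  have hm0 := hm.1
  have hβ0 : 0 ≤ β := by linarith
  rcases eq_or_ne d 0 with rfl | hd
  · have hself : ∀ x y : Euc 0, x = y := fun x y => Subsingleton.elim x y
    have hzero : ∀ x y, fdtm m p β μ F x y = 0 := fun x y => by
      have : {L : ℝ | ∃ γ, AdmissiblePath F x y γ ∧ L = fdtmLength m p β μ γ} = ∅ := by
        refine eq_empty_of_forall_notMem ?_
        rintro _ ⟨γ, hγ, -⟩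
        obtain ⟨u, hu, -⟩ := hγ.2.2.2 1 0 zero_le_one zero_le_one (by simp)
        simp [hself u 0] at hu
      rw [fdtm, this, Real.sInf_empty]
    refine ⟨?_, ?_, ?_, fun x _ y _ => by simp [hzero, hself x y],
      fun x _ ε hε => ⟨1, one_pos, fun y _ _ => by simpa [hzero]⟩,
      fun x _ ε hε => ⟨1, one_pos, fun y _ _ => by simpa [hself x y]⟩⟩ <;> simp [hzero]
  · refine ⟨fun x _ y _ => fdtm_nonneg hm0.le, fun x _ y _ => fdtm_comm m p β μ F x y,
      fun x _ y hy z _ => fdtm_triangle hd hm hp hβ0 hy, fun x _ y _ => ⟨fun h => ?_, ?_⟩,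
      fun x _ ε hε => ?_, fun x _ ε hε => ?_⟩
    · refine dist_le_zero.1 (le_of_forall_pos_le_add fun ε hε => ?_)
      obtain ⟨η, hη, hdist⟩ := exists_pos_forall_dist_lt (μ := μ) hd hm hp hβ0 F x hε
      linarith [hdist y (h ▸ hη)]
    · rintro rfl
      obtain ⟨C, -, hC⟩ := exists_forall_fdtm_le_mul_dist (μ := μ) hd hm hp hβ0 F x
      exact le_antisymm (by simpa using hC x (by simp)) (fdtm_nonneg hm0.le)
    · obtain ⟨C, hC0, hC⟩ := exists_forall_fdtm_le_mul_dist (μ := μ) hd hm hp hβ0 F x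
      refine ⟨min 1 (ε / C), by positivity, fun y _ hy => ?_⟩
      rw [lt_min_iff, lt_div_iff₀ hC0] at hy
      linarith [hC y hy.1]
    · obtain ⟨η, hη, hdist⟩ := exists_pos_forall_dist_lt (μ := μ) hd hm hp hβ0 F x hε
      exact ⟨η, hη, fun y _ => hdist y⟩

end
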